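/- arXiv:1611.10101 — 2 statements merged into one kernel-verified Lean document; each statement's English description precedes it below -/
import Mathlib

section
/- Let k be an algebraically closed field of characteristic zero containing ε with ord(ε) = 5. Every subgroup of PGL_4(k) isomorphic to Z/5Z is conjugate to one of the five cyclic subgroups generated by the images of the diagonal matrices diag[1,1,ε,1], diag[1,1,ε,ε], diag[1,1,ε,ε²], diag[1,1,ε,ε⁴], and diag[1,ε,ε²,ε³]. -/
open Matrix

/-- The diagonal matrix with unit entries, as an element of `GL (Fin 4) k`. -/
noncomputable def diagGL {k : Type*} [Field k] (u : Fin 4 → kˣ) :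
    Matrix.GeneralLinearGroup (Fin 4) k where
  val := Matrix.diagonal fun i => (u i : k)
  inv := Matrix.diagonal fun i => ((u i)⁻¹ : kˣ)
  val_inv := by
    rw [Matrix.diagonal_mul_diagonal]
    simp [← Units.val_mul]
  inv_val := by
    rw [Matrix.diagonal_mul_diagonal]
    simp [← Units.val_mul]

open Module in
/-- An endomorphism of finite order over an algebraically closed field of characteristic zero
has a basis of eigenvectors. -/
theorem exists_eigenbasis_of_pow_eq_one {k : Type*} [Field k] [IsAlgClosed k] [CharZero k]
    {m n : ℕ} (hm : m ≠ 0) (f : End k (Fin n → k)) (hf : f ^ m = 1) :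
    ∃ (b : Basis (Fin n) k (Fin n → k)) (μ : Fin n → k), ∀ i, f (b i) = μ i • b i := by
  have hss : f.IsSemisimple := by
    refine End.isSemisimple_of_squarefree_aeval_eq_zero
      (p := Polynomial.X ^ m - 1) ?_ (by simp [hf])
    exact (Polynomial.X_pow_sub_one_separable_iff.2 (by exact_mod_cast hm)).squarefree
  have htop := hss.iSup_eigenspace_eq_top
  let s : Set (Fin n → k) := ⋃ μ, (f.eigenspace μ : Set (Fin n → k))
  have hs : ⊤ ≤ Submodule.span k s := by
    rw [← htop, iSup_le_iff]
    exact fun μ => (Set.subset_iUnion (fun μ => (f.eigenspace μ : Set (Fin n → k))) μ).trans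
      Submodule.subset_span
  let b₀ := Basis.ofSpan hs
  let b := b₀.reindex (b₀.indexEquiv (Pi.basisFun k (Fin n)))
  have hb : ∀ i, ∃ μ : k, f (b i) = μ • b i := by
    intro i
    have hi : b i ∈ s := by
      simp only [b, Basis.reindex_apply]
      exact Basis.ofSpan_subset hs (Set.mem_range_self _)
    obtain ⟨μ, hμ⟩ := Set.mem_iUnion.1 hi
    exact ⟨μ, End.mem_eigenspace_iff.1 hμ⟩
  choose μ hμ using hb
  exact ⟨b, μ, hμ⟩

/-- A matrix with a basis of eigenvectors is conjugate to the diagonal matrix of its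
eigenvalues. -/
theorem exists_conj_eq_diagGL {k : Type*} [Field k] (B : GL (Fin 4) k)
    (b : Module.Basis (Fin 4) k (Fin 4 → k)) (u : Fin 4 → kˣ)
    (h : ∀ i, (B : Matrix (Fin 4) (Fin 4) k).mulVec (b i) = (u i : k) • b i) :
    ∃ P : GL (Fin 4) k, P * B * P⁻¹ = diagGL u := by
  let := (Pi.basisFun k (Fin 4)).invertibleToMatrix b
  let P : GL (Fin 4) k := unitOfInvertible ((Pi.basisFun k (Fin 4)).toMatrix b)
  refine ⟨P⁻¹, ?_⟩
  rw [inv_inv, mul_assoc, inv_mul_eq_iff_eq_mul]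
  ext i j
  have := congrFun (h j) i
  simp only [Units.val_mul, diagGL, Matrix.mul_diagonal, P, val_unitOfInvertible]
  simpa [Matrix.mul_apply, Matrix.mulVec, dotProduct, Module.Basis.toMatrix_apply, mul_comm] using this

theorem diagGL_mul {k : Type*} [Field k] (u v : Fin 4 → kˣ) :
    diagGL (u * v) = diagGL u * diagGL v := by
  ext i j
  simp [diagGL, Matrix.diagonal_apply]; split_ifs with h <;> simp [h]

theorem diagGL_pow {k : Type*} [Field k] (u : Fin 4 → kˣ) (n : ℕ) :
    diagGL (u ^ n) = diagGL u ^ n := by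
  induction n with
  | zero => ext i j; simp [diagGL]
  | succ n ih => rw [pow_succ, pow_succ, diagGL_mul, ih]

theorem diagGL_const_mem_center {k : Type*} [Field k] (a : kˣ) :
    diagGL (fun _ => a) ∈ Subgroup.center (GL (Fin 4) k) := by
  rw [GeneralLinearGroup.center_eq_range_scalar]
  exact ⟨a, by ext i j; simp [diagGL]⟩

/-- Over an algebraically closed field, a projective transformation killed by `m ≠ 0` lifts to a
matrix killed by `m`. -/
theorem exists_lift_pow_eq_one {k : Type*} [Field k] [IsAlgClosed k] {m n : ℕ} (hm : m ≠ 0)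
    (g : GL (Fin n) k ⧸ Subgroup.center (GL (Fin n) k)) (hg : g ^ m = 1) :
    ∃ B : GL (Fin n) k, (B : GL (Fin n) k ⧸ Subgroup.center (GL (Fin n) k)) = g ∧ B ^ m = 1 := by
  obtain ⟨A, rfl⟩ := QuotientGroup.mk_surjective g
  rw [← QuotientGroup.mk_pow, QuotientGroup.eq_one_iff,
    GeneralLinearGroup.center_eq_range_scalar] at hg
  obtain ⟨c, hc⟩ := hg
  obtain ⟨d, hd⟩ := IsAlgClosed.exists_pow_nat_eq (c : k) (Nat.pos_of_ne_zero hm)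
  have hd0 : d ≠ 0 := by
    rintro rfl
    exact c.ne_zero (by rw [← hd, zero_pow hm])
  have hdc : Units.mk0 d hd0 ^ m = c := Units.ext (by simpa using hd)
  refine ⟨(GeneralLinearGroup.scalar (Fin n) (Units.mk0 d hd0))⁻¹ * A, ?_, ?_⟩
  · rw [QuotientGroup.eq, _root_.mul_inv_rev, inv_inv, mul_assoc,
      GeneralLinearGroup.scalar_commute, inv_mul_cancel_left, GeneralLinearGroup.center_eq_range_scalar]
    exact ⟨_, rfl⟩
  · have hcomm : Commute (GeneralLinearGroup.scalar (Fin n) (Units.mk0 d hd0)) A :=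
      GeneralLinearGroup.scalar_commute _ _
    rw [hcomm.inv_left.mul_pow, ← hc, inv_pow, ← map_pow, hdc, inv_mul_cancel]

/-- A subgroup isomorphic to `ℤ/pℤ` is generated by an element of order `p`. -/
theorem exists_zpowers_eq_of_mulEquiv_zmod {H : Type*} [Group H] {p : ℕ} (G : Subgroup H)
    (φ : G ≃* Multiplicative (ZMod p)) : ∃ g : H, orderOf g = p ∧ Subgroup.zpowers g = G := by
  have : IsCyclic G := isCyclic_of_surjective φ.symm φ.symm.surjective
  obtain ⟨g, rfl⟩ := (Subgroup.isCyclic_iff_exists_zpowers_eq_top G).1 this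
  refine ⟨g, ?_, rfl⟩
  rw [← Nat.card_zpowers, Nat.card_congr φ.toEquiv, Nat.card_congr Multiplicative.toAdd, Nat.card_zmod]

/-- Four residues modulo `5`, two of which agree, are affinely equivalent to one of four normal
forms. -/
theorem exists_affine_perm_of_pair : ∀ c d : ZMod 5, ¬ (c = 0 ∧ d = 0) →
    ∃ e ∈ ([![0,0,1,0], ![0,0,1,1], ![0,0,1,2], ![0,0,1,4]] : List (Fin 4 → ZMod 5)),
      ∃ s t : ZMod 5, s * t = 1 ∧ ∃ σ ∈ ([1, Equiv.swap 2 3] : List (Equiv.Perm (Fin 4))),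
        ∀ i, (![0, 0, c, d] : Fin 4 → ZMod 5) (σ i) = s * e i := by
  decide +kernel

/-- Four distinct residues modulo `5` form a translate of `0, 1, 2, 3`. -/
theorem exists_translate_perm_of_ne : ∀ b c d : ZMod 5,
    b ≠ 0 → c ≠ 0 → d ≠ 0 → b ≠ c → b ≠ d → c ≠ d →
    ∃ z : ZMod 5, ∃ σ : Equiv.Perm (Fin 4),
      ∀ i, (![0, b, c, d] : Fin 4 → ZMod 5) (σ i) = (![0, 1, 2, 3] : Fin 4 → ZMod 5) i + z := by
  decide +kernel

theorem exists_perm_apply_zero_one : ∀ i j : Fin 4, i ≠ j →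
    ∃ τ : Equiv.Perm (Fin 4), τ 0 = i ∧ τ 1 = j := by
  decide +kernel

/-- Four residues modulo `5`, not all equal, are affinely equivalent to one of five normal
forms. -/
theorem exists_affine_perm (n : Fin 4 → ZMod 5) (hn : ¬ ∀ i j, n i = n j) :
    ∃ e ∈ ({![0,0,1,0], ![0,0,1,1], ![0,0,1,2], ![0,0,1,4], ![0,1,2,3]} :
        Set (Fin 4 → ZMod 5)),
      ∃ s t z : ZMod 5, s * t = 1 ∧ ∃ σ : Equiv.Perm (Fin 4), ∀ i, n (σ i) = s * e i + z := by
  by_cases hinj : Function.Injective n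
  · have hne : ∀ i j, i ≠ j → n i - n 0 ≠ n j - n 0 := fun i j hij h =>
      hij (hinj (sub_left_injective h))
    obtain ⟨z, σ, hσ⟩ := exists_translate_perm_of_ne (n 1 - n 0) (n 2 - n 0) (n 3 - n 0)
      (by simpa using hne 1 0 (by decide)) (by simpa using hne 2 0 (by decide))
      (by simpa using hne 3 0 (by decide)) (hne 1 2 (by decide)) (hne 1 3 (by decide))
      (hne 2 3 (by decide))
    refine ⟨![0, 1, 2, 3], by simp, 1, 1, z + n 0, one_mul 1, σ, fun i => ?_⟩
    have hv : ∀ j, (![0, n 1 - n 0, n 2 - n 0, n 3 - n 0] : Fin 4 → ZMod 5) j = n j - n 0 := by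
      intro j; fin_cases j <;> simp
    rw [one_mul, ← add_assoc, ← hσ i, hv, sub_add_cancel]
  · obtain ⟨i, j, hij, hne⟩ := Function.not_injective_iff.1 hinj
    obtain ⟨τ, rfl, rfl⟩ := exists_perm_apply_zero_one i j hne
    have hv : ∀ j, (![0, 0, n (τ 2) - n (τ 0), n (τ 3) - n (τ 0)] : Fin 4 → ZMod 5) j =
        n (τ j) - n (τ 0) := by
      intro j; fin_cases j <;> simp [hij]
    obtain ⟨e, he, s, t, hst, σ, -, hσ⟩ :=
      exists_affine_perm_of_pair (n (τ 2) - n (τ 0)) (n (τ 3) - n (τ 0)) (by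
        rintro ⟨h2, h3⟩
        have h : ∀ j, n (τ j) = n (τ 0) := by
          intro j
          rw [← sub_eq_zero, ← hv j]
          fin_cases j <;> simp [h2, h3]
        apply hn
        intro i j
        rw [← τ.apply_symm_apply i, ← τ.apply_symm_apply j, h, h (τ.symm j)])
    refine ⟨e, ?_, s, t, n (τ 0), hst, σ.trans τ, fun i => ?_⟩
    · simp only [List.mem_cons, List.not_mem_nil, or_false] at he
      simp only [Set.mem_insert_iff, Set.mem_singleton_iff]
      tauto
    · rw [← hσ i, hv, Equiv.trans_apply, sub_add_cancel]

theorem pow_zmod_val_mul_add {M : Type*} [Group M] {m : ℕ} [NeZero m] {ε : M} (hε : ε ^ m = 1)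
    (s x z : ZMod m) : ε ^ (s * x + z).val = (ε ^ x.val) ^ s.val * ε ^ z.val := by
  rw [← pow_mul, ← pow_add, pow_eq_pow_iff_modEq]
  refine Nat.ModEq.of_dvd (orderOf_dvd_of_pow_eq_one hε) ((ZMod.natCast_eq_natCast_iff _ _ _).1 ?_)
  simp [mul_comm]

theorem Subgroup.zpowers_pow_eq {H : Type*} [Group H] {m : ℕ} [NeZero m] {d : H} (hd : d ^ m = 1)
    {s t : ZMod m} (hst : s * t = 1) : Subgroup.zpowers (d ^ s.val) = Subgroup.zpowers d := by
  refine le_antisymm (by simp) ?_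
  rw [Subgroup.zpowers_le]
  have h : (d ^ s.val) ^ t.val = d := by
    rw [← pow_mul]
    conv_rhs => rw [← pow_one d]
    rw [pow_eq_pow_iff_modEq]
    refine Nat.ModEq.of_dvd (orderOf_dvd_of_pow_eq_one hd)
      ((ZMod.natCast_eq_natCast_iff _ _ _).1 ?_)
    simpa using hst
  have hmem := Subgroup.npow_mem_zpowers (d ^ s.val) t.val
  rwa [h] at hmem

/-- A matrix `B` with `B ^ m = 1` has a basis of eigenvectors with eigenvalues powers of a given
primitive `m`-th root of unity. -/
theorem exists_eigenbasis_pow_root {k : Type*} [Field k] [IsAlgClosed k] [CharZero k]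
    {m n : ℕ} [NeZero m] {ε : kˣ} (hε : orderOf ε = m) {B : GL (Fin n) k} (hB : B ^ m = 1) :
    ∃ (b : Module.Basis (Fin n) k (Fin n → k)) (x : Fin n → ZMod m),
      ∀ i, (B : Matrix (Fin n) (Fin n) k).mulVec (b i) = ((ε ^ (x i).val : kˣ) : k) • b i := by
  have hf : (Matrix.toLin' (B : Matrix (Fin n) (Fin n) k)) ^ m = 1 := by
    rw [← Matrix.toLin'_pow, ← Units.val_pow_eq_pow_val, hB, Units.val_one, Matrix.toLin'_one]
    rfl
  obtain ⟨b, μ, hμ⟩ := exists_eigenbasis_of_pow_eq_one (NeZero.ne m) _ hf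
  have hpow : ∀ i, μ i ^ m = 1 := by
    intro i
    have h : ∀ l : ℕ, ((Matrix.toLin' (B : Matrix (Fin n) (Fin n) k)) ^ l) (b i) =
        μ i ^ l • b i := by
      intro l
      induction l with
      | zero => simp
      | succ l ih => rw [pow_succ', Module.End.mul_apply, ih, map_smul, hμ, smul_smul, pow_succ]
    have h5 := h m
    rw [hf, Module.End.one_apply] at h5
    have h0 : (μ i ^ m - 1) • b i = 0 := by rw [sub_smul, one_smul, ← h5, sub_self]
    exact sub_eq_zero.1 ((smul_eq_zero.1 h0).resolve_right (b.ne_zero i))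
  have hprim : IsPrimitiveRoot (ε : k) m :=
    IsPrimitiveRoot.coe_units_iff.2 (hε ▸ IsPrimitiveRoot.orderOf ε)
  have hx : ∀ i, ∃ x : ZMod m, ((ε ^ x.val : kˣ) : k) = μ i := by
    intro i
    obtain ⟨j, hj, hji⟩ := hprim.eq_pow_of_pow_eq_one (hpow i)
    exact ⟨j, by rw [ZMod.val_cast_of_lt hj, Units.val_pow_eq_pow_val, hji]⟩
  choose x hx using hx
  exact ⟨b, x, fun i => by rw [hx, ← hμ, Matrix.toLin'_apply]⟩

/-- every subgroup of `PGL₄(k)` isomorphic to `ℤ/5ℤ` is conjugate to one of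
the five cyclic subgroups generated by the images of the diagonal matrices
`diag[1,1,ε,1]`, `diag[1,1,ε,ε]`, `diag[1,1,ε,ε²]`, `diag[1,1,ε,ε⁴]`, `diag[1,ε,ε²,ε³]`,
where `ε` is a primitive 5th root of unity. -/
theorem stmt_5 {k : Type*} [Field k] [IsAlgClosed k] [CharZero k] (ε : kˣ)
    (hε : orderOf ε = 5)
    (G : Subgroup (Matrix.GeneralLinearGroup (Fin 4) k ⧸
      Subgroup.center (Matrix.GeneralLinearGroup (Fin 4) k)))
    (hG : Nonempty (G ≃* Multiplicative (ZMod 5))) :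
    ∃ D ∈ ({![1, 1, ε, 1], ![1, 1, ε, ε], ![1, 1, ε, ε ^ 2], ![1, 1, ε, ε ^ 4],
        ![1, ε, ε ^ 2, ε ^ 3]} : Set (Fin 4 → kˣ)),
      ∃ T, Subgroup.map (MulAut.conj T).toMonoidHom G =
        Subgroup.zpowers (QuotientGroup.mk (diagGL D)) := by
  obtain ⟨φ⟩ := hG
  obtain ⟨g, hg, rfl⟩ := exists_zpowers_eq_of_mulEquiv_zmod G φ
  have hε5 : ε ^ 5 = 1 := hε ▸ pow_orderOf_eq_one ε
  obtain ⟨B, rfl, hB⟩ :=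
    exists_lift_pow_eq_one (by norm_num : 5 ≠ 0) g (hg ▸ pow_orderOf_eq_one g)
  obtain ⟨b, x, hb⟩ := exists_eigenbasis_pow_root hε hB
  have hx : ¬ ∀ i j, x i = x j := by
    intro hx
    obtain ⟨P, hP⟩ := exists_conj_eq_diagGL B b (fun _ => ε ^ (x 0).val) fun i => by
      rw [hb, hx i 0]
    have hmem : B ∈ Subgroup.center (GL (Fin 4) k) := by
      have h := diagGL_const_mem_center (ε ^ (x 0).val)
      rw [← hP] at h
      simpa [mul_assoc] using
        (inferInstance : (Subgroup.center (GL (Fin 4) k)).Normal).conj_mem _ h P⁻¹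
    rw [(QuotientGroup.eq_one_iff B).2 hmem, orderOf_one] at hg
    norm_num at hg
  obtain ⟨e, he, s, t, z, hst, σ, hσ⟩ := exists_affine_perm x hx
  obtain ⟨P, hP⟩ := exists_conj_eq_diagGL B (b.reindex σ.symm) (fun i => ε ^ (x (σ i)).val)
    fun i => by simpa using hb (σ i)
  let D : Fin 4 → kˣ := fun i => ε ^ (e i).val
  have hD : D ^ 5 = 1 := by
    ext i
    simp only [D, Pi.pow_apply]
    rw [← pow_mul, mul_comm, pow_mul, hε5, one_pow, Pi.one_apply]
  have hdiag : (fun i => ε ^ (x (σ i)).val) = D ^ s.val * fun _ => ε ^ z.val := by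
    funext i
    rw [hσ, pow_zmod_val_mul_add hε5]
    rfl
  have hd : (QuotientGroup.mk (diagGL D) :
      GL (Fin 4) k ⧸ Subgroup.center (GL (Fin 4) k)) ^ 5 = 1 := by
    rw [← QuotientGroup.mk_pow, ← diagGL_pow, hD, ← pow_zero (1 : Fin 4 → kˣ), diagGL_pow, pow_zero,
      QuotientGroup.mk_one]
  refine ⟨D, ?_, QuotientGroup.mk P, ?_⟩
  · simp only [Set.mem_insert_iff, Set.mem_singleton_iff] at he ⊢
    have hone : (1 : ZMod 5).val = 1 := rfl
    have htwo : (2 : ZMod 5).val = 2 := rfl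
    have hthree : (3 : ZMod 5).val = 3 := rfl
    have hfour : (4 : ZMod 5).val = 4 := rfl
    refine he.imp ?_ (Or.imp ?_ (Or.imp ?_ (Or.imp ?_ ?_))) <;>
    · rintro rfl
      funext i
      fin_cases i <;> simp [D, hone, htwo, hthree, hfour]
  · rw [MonoidHom.map_zpowers, MulEquiv.coe_toMonoidHom, MulAut.conj_apply, ← QuotientGroup.mk_inv,
      ← QuotientGroup.mk_mul, ← QuotientGroup.mk_mul, hP, hdiag, diagGL_mul, QuotientGroup.mk_mul,
      (QuotientGroup.eq_one_iff (diagGL fun _ => ε ^ z.val)).2 (diagGL_const_mem_center _),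
      mul_one, diagGL_pow, QuotientGroup.mk_pow, Subgroup.zpowers_pow_eq hd hst]
end

section
/- Let G = Paut(f) be the projective automorphism group of a nonsingular quartic form f ∈ k[x,y,z,t] over an algebraically closed field k of characteristic zero. Then 49 does not divide |G|. -/
open MvPolynomial

/-- A quartic form in `k[x,y,z,t]` is singular if its four partial derivatives have a common
zero in `k⁴ \ {0}`. -/
def MvPolynomial.IsSingularForm {k : Type*} [CommRing k] (f : MvPolynomial (Fin 4) k) : Prop :=
  ∃ p : Fin 4 → k, p ≠ 0 ∧ ∀ i : Fin 4, eval p (pderiv i f) = 0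

/-- The linear substitution action of a matrix on polynomials:
`substM A f = f ∘ A`, i.e. `x_i ↦ ∑ j, A i j * x_j`. -/
noncomputable def substM {k : Type*} [CommSemiring k] (A : Matrix (Fin 4) (Fin 4) k)
    (f : MvPolynomial (Fin 4) k) : MvPolynomial (Fin 4) k :=
  aeval (fun i => ∑ j : Fin 4, MvPolynomial.C (A i j) * X j) f

/-- `(A) ∈ PGL₄(k)` is a projective automorphism of the form `f` if the substitution by
`A⁻¹` sends `f` to a nonzero scalar multiple of itself. -/
def IsProjAut {k : Type*} [Field k] (f : MvPolynomial (Fin 4) k)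
    (A : Matrix.GeneralLinearGroup (Fin 4) k) : Prop :=
  ∃ c : kˣ, substM (↑(A⁻¹) : Matrix (Fin 4) (Fin 4) k) f = (c : k) • f

/-- The number of projective automorphisms of `f`, i.e. `|Paut(f)|`, counted as a subset of
`PGL₄(k) = GL₄(k)/center`. -/
noncomputable def pautCard {k : Type*} [Field k] (f : MvPolynomial (Fin 4) k) : ℕ :=
  Nat.card {x : Matrix.GeneralLinearGroup (Fin 4) k ⧸
      Subgroup.center (Matrix.GeneralLinearGroup (Fin 4) k) //
    ∃ A : Matrix.GeneralLinearGroup (Fin 4) k, QuotientGroup.mk A = x ∧ IsProjAut f A}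

/-- The gradient of a multivariate polynomial at a point. -/
noncomputable def MvPolynomial.gradientAt {R σ : Type*} [CommSemiring R] (f : MvPolynomial σ R)
    (p : σ → R) : σ → R :=
  fun i => eval p (pderiv i f)

theorem MvPolynomial.derivation_aeval {R S σ : Type*} [CommRing R] [CommRing S] [Algebra R S]
    [Fintype σ] (D : Derivation R S S) (P : σ → S) (g : MvPolynomial σ R) :
    D (aeval P g) = ∑ i, aeval P (pderiv i g) * D (P i) := by
  classical
  induction g using MvPolynomial.induction_on with
  | C a => simp
  | add p q hp hq => simp [hp, hq, add_mul, Finset.sum_add_distrib]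
  | mul_X p j hp =>
    simp only [map_mul, aeval_X, Derivation.leibniz, hp, pderiv_X, smul_eq_mul, map_add,
      add_mul, Finset.sum_add_distrib, Pi.single_apply, mul_ite, mul_one, mul_zero]
    congr 1
    · simp [apply_ite (aeval P), ite_mul]
    · rw [Finset.mul_sum]
      exact Finset.sum_congr rfl fun i _ => by ring

theorem MvPolynomial.pderiv_pderiv_comm {R σ : Type*} [CommRing R] (i j : σ)
    (g : MvPolynomial σ R) : pderiv i (pderiv j g) = pderiv j (pderiv i g) := by
  classical
  ext m
  simp only [coeff_pderiv, Finsupp.add_apply, Finsupp.single_apply, add_right_comm m]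
  rcases eq_or_ne i j with rfl | hij
  · rfl
  · simp [hij, hij.symm]
    ring

theorem MvPolynomial.IsHomogeneous.eval_smul {R σ : Type*} [CommSemiring R]
    {g : MvPolynomial σ R} {n : ℕ} (hg : g.IsHomogeneous n) (c : R) (p : σ → R) :
    eval (c • p) g = c ^ n * eval p g := by
  rw [eval_eq, eval_eq, Finset.mul_sum]
  refine Finset.sum_congr rfl fun d hd => ?_
  have h := hg (mem_support_iff.mp hd)
  rw [Finsupp.weight_apply, Finsupp.sum] at h
  simp only [Pi.smul_apply, smul_eq_mul, mul_pow, Finset.prod_mul_distrib,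
    Finset.prod_pow_eq_pow_sum, Pi.one_apply, mul_one] at h ⊢
  rw [h]
  ring

theorem MvPolynomial.IsHomogeneous.coeff_aeval_of_natDegree_le {R σ : Type*} [CommSemiring R]
    {g : MvPolynomial σ R} {n : ℕ} (hg : g.IsHomogeneous n) {P : σ → Polynomial R} {m : ℕ}
    (hP : ∀ i, (P i).natDegree ≤ m) :
    (MvPolynomial.aeval P g).coeff (n * m) = eval (fun i => (P i).coeff m) g := by
  have key : ∀ d : σ →₀ ℕ, (∏ i ∈ d.support, P i ^ d i).coeff ((∑ i ∈ d.support, d i) * m) =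
      ∏ i ∈ d.support, (P i).coeff m ^ d i ∧
      (∏ i ∈ d.support, P i ^ d i).natDegree ≤ (∑ i ∈ d.support, d i) * m := by
    intro d
    classical
    induction d.support using Finset.induction_on with
    | empty => simp
    | insert a s ha ih =>
      rw [Finset.prod_insert ha, Finset.prod_insert ha, Finset.sum_insert ha, add_mul]
      have h1 := Polynomial.natDegree_pow_le_of_le (d a) (hP a)
      refine ⟨?_, Polynomial.natDegree_mul_le_of_le h1 ih.2⟩
      rw [Polynomial.coeff_mul_add_eq_of_natDegree_le h1 ih.2, ih.1,
        Polynomial.coeff_pow_of_natDegree_le (hP a)]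
  rw [aeval_def, eval₂_eq, eval_eq, Polynomial.finsetSum_coeff]
  refine Finset.sum_congr rfl fun d hd => ?_
  have h := hg (mem_support_iff.mp hd)
  rw [Finsupp.weight_apply, Finsupp.sum] at h
  simp only [Pi.one_apply, smul_eq_mul, mul_one] at h
  rw [Polynomial.algebraMap_eq, Polynomial.coeff_C_mul, ← h, (key d).1]

section LinearVectorField

variable {k : Type*} [Field k] {σ : Type*} [Fintype σ] [DecidableEq σ]

theorem sum_mul_pderiv_add_sum_mul_pderiv_pderiv {E : Matrix σ σ k} {f : MvPolynomial σ k}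
    (hE : ∑ i, (∑ j, C (E i j) * X j) * pderiv i f = 0) (l : σ) :
    ∑ i, C (E i l) * pderiv i f + ∑ i, (∑ j, C (E i j) * X j) * pderiv i (pderiv l f) = 0 := by
  have h := congrArg (pderiv l) hE
  rw [map_sum, map_zero] at h
  rw [← h, ← Finset.sum_add_distrib]
  refine Finset.sum_congr rfl fun i _ => ?_
  rw [Derivation.leibniz, map_sum]
  have h1 : ∑ j, pderiv l (C (E i j) * X j) = C (E i l) := by
    simp [Derivation.leibniz, pderiv_X, Pi.single_apply]
  have h2 := pderiv_pderiv_comm l i f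
  rw [h1, h2, smul_eq_mul, smul_eq_mul]
  ring

/-- If a linear vector field annihilates a form of degree `n + 1` and has `μ` as eigenvalue,
then the gradient at an eigenvector is an eigenvector of the transpose for `-n * μ`. -/
theorem transpose_mulVec_gradientAt {E : Matrix σ σ k} {f : MvPolynomial σ k} {n : ℕ}
    (hf : f.IsHomogeneous (n + 1))
    (hE : ∑ i, (∑ j, C (E i j) * X j) * pderiv i f = 0) {μ : k} {v : σ → k}
    (hv : E.mulVec v = μ • v) :
    E.transpose.mulVec (f.gradientAt v) = (-n * μ) • f.gradientAt v := by
  ext l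
  have h := congrArg (eval v) (sum_mul_pderiv_add_sum_mul_pderiv_pderiv hE l)
  have euler := congrArg (eval v) (hf.pderiv (i := l)).sum_X_mul_pderiv
  have hv' : ∀ i, ∑ j, E i j * v j = μ * v i := fun i => congrFun hv i
  simp only [map_add, map_sum, map_mul, eval_C, eval_X, map_zero, hv', Nat.add_sub_cancel,
    nsmul_eq_mul, map_natCast] at h euler
  simp only [mul_assoc, ← Finset.mul_sum, euler] at h
  simp only [Matrix.mulVec, dotProduct, Matrix.transpose_apply, Pi.smul_apply, smul_eq_mul,
    MvPolynomial.gradientAt]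
  linear_combination h

theorem isNilpotent_of_sum_mul_pderiv_eq_zero [IsAlgClosed k] [CharZero k] {E : Matrix σ σ k}
    {f : MvPolynomial σ k} {n : ℕ} (hn : 2 ≤ n) (hf : f.IsHomogeneous (n + 1))
    (hns : ∀ p, f.gradientAt p = 0 → p = 0)
    (hE : ∑ i, (∑ j, C (E i j) * X j) * pderiv i f = 0) : IsNilpotent E := by
  have step : ∀ μ ∈ spectrum k E, -n * μ ∈ spectrum k E := by
    intro μ hμ
    rw [← Matrix.spectrum_toLin', ← Module.End.hasEigenvalue_iff_mem_spectrum] at hμ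
    obtain ⟨v, hv⟩ := hμ.exists_hasEigenvector
    have h := transpose_mulVec_gradientAt hf hE (by simpa using hv.apply_eq_smul)
    have h0 : f.gradientAt v ≠ 0 := fun h0 => hv.2 (hns v h0)
    have h1 : Module.End.HasEigenvalue (Matrix.toLin' E.transpose) (-n * μ) :=
      Module.End.hasEigenvalue_of_hasEigenvector (x := f.gradientAt v)
        ⟨by rw [Module.End.mem_eigenspace_iff]; simpa using h, h0⟩
    rw [Module.End.hasEigenvalue_iff_mem_spectrum, Matrix.spectrum_toLin'] at h1
    rw [Matrix.mem_spectrum_iff_isRoot_charpoly] at h1 ⊢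
    rwa [Matrix.charpoly_transpose] at h1
  have hzero : ∀ μ ∈ spectrum k E, μ = 0 := by
    intro μ hμ
    by_contra h0
    have hmem : ∀ j : ℕ, (-n : k) ^ j * μ ∈ spectrum k E := by
      intro j
      induction j with
      | zero => simpa using hμ
      | succ j ih => rw [pow_succ', mul_assoc]; exact step _ ih
    have hinj : Function.Injective fun j : ℕ => (-n : k) ^ j * μ := by
      intro a b hab
      have h1 := mul_right_cancel₀ h0 hab
      have h2 : (-n : ℤ) ^ a = (-n : ℤ) ^ b := by exact_mod_cast h1
      have h3 := congrArg Int.natAbs h2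
      simp only [Int.natAbs_pow, Int.natAbs_neg, Int.natAbs_natCast] at h3
      exact Nat.pow_right_injective hn h3
    exact Set.infinite_of_injective_forall_mem hinj hmem (Matrix.finite_spectrum E)
  have hch : E.charpoly = Polynomial.X ^ Fintype.card σ := by
    have hs := IsAlgClosed.splits E.charpoly
    have hroots : E.charpoly.roots = Multiset.replicate (Fintype.card σ) 0 := by
      rw [Multiset.eq_replicate, ← hs.natDegree_eq_card_roots, Matrix.charpoly_natDegree_eq_dim]
      refine ⟨rfl, fun μ hμ => hzero μ ?_⟩
      rw [Matrix.mem_spectrum_iff_isRoot_charpoly]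
      exact Polynomial.isRoot_of_mem_roots hμ
    rw [hs.eq_prod_roots_of_monic (Matrix.charpoly_monic E), hroots]
    simp
  refine ⟨Fintype.card σ, ?_⟩
  have := Matrix.aeval_self_charpoly E
  rwa [hch, map_pow, Polynomial.aeval_X] at this

/-- The truncated exponential `∑ tⁿ Eⁿ u / n!`. -/
noncomputable def truncExp (E : Matrix σ σ k) (u : σ → k) (m : ℕ) (i : σ) : Polynomial k :=
  ∑ n ∈ Finset.range (m + 1), Polynomial.C ((E ^ n).mulVec u i / (n.factorial : k)) *
    Polynomial.X ^ n

theorem truncExp_natDegree_le (E : Matrix σ σ k) (u : σ → k) (m : ℕ) (i : σ) :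
    (truncExp E u m i).natDegree ≤ m :=
  Polynomial.natDegree_sum_le_of_forall_le _ _ fun n hn =>
    (Polynomial.natDegree_C_mul_X_pow_le _ n).trans (Nat.lt_succ_iff.mp (Finset.mem_range.mp hn))

theorem truncExp_coeff {E : Matrix σ σ k} {m : ℕ} (hE : E ^ (m + 1) = 0) (u : σ → k) (i : σ)
    (n : ℕ) : (truncExp E u m i).coeff n = (E ^ n).mulVec u i / (n.factorial : k) := by
  simp only [truncExp, Polynomial.finsetSum_coeff, Polynomial.coeff_C_mul_X_pow,
    Finset.sum_ite_eq, Finset.mem_range]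
  split_ifs with h
  · rfl
  · rw [pow_eq_zero_of_le (not_lt.mp h) hE]
    simp

theorem derivative_truncExp [CharZero k] {E : Matrix σ σ k} {m : ℕ} (hE : E ^ (m + 1) = 0)
    (u : σ → k) (i : σ) :
    Polynomial.derivative (truncExp E u m i) = ∑ j, Polynomial.C (E i j) * truncExp E u m j := by
  ext n
  simp only [Polynomial.coeff_derivative, Polynomial.finsetSum_coeff, Polynomial.coeff_C_mul,
    truncExp_coeff hE]
  rw [pow_succ', ← Matrix.mulVec_mulVec, Nat.factorial_succ]
  have h1 : ((n + 1 : ℕ) : k) ≠ 0 := Nat.cast_ne_zero.mpr n.succ_ne_zero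
  have h2 : (n.factorial : k) ≠ 0 := Nat.cast_ne_zero.mpr n.factorial_ne_zero
  simp only [← mul_div_assoc, ← Finset.sum_div]
  rw [Matrix.mulVec, dotProduct]
  push_cast at h1 ⊢
  field_simp

/-- The pairing of a vector with the gradient of `f` along `truncExp E u m`. -/
noncomputable def truncExpGradient (E : Matrix σ σ k) (f : MvPolynomial σ k) (u : σ → k) (m : ℕ)
    (w : σ → k) : Polynomial k :=
  ∑ l, Polynomial.C (w l) * aeval (truncExp E u m) (pderiv l f)

theorem derivative_truncExpGradient [CharZero k] {E : Matrix σ σ k} {f : MvPolynomial σ k}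
    (hE : ∑ i, (∑ j, C (E i j) * X j) * pderiv i f = 0) {m : ℕ} (hpow : E ^ (m + 1) = 0)
    (u w : σ → k) :
    Polynomial.derivative (truncExpGradient E f u m w) =
      -truncExpGradient E f u m (E.mulVec w) := by
  have hl : ∀ l, Polynomial.derivative (aeval (truncExp E u m) (pderiv l f)) =
      -∑ i, Polynomial.C (E i l) * aeval (truncExp E u m) (pderiv i f) := by
    intro l
    have h := congrArg (aeval (truncExp E u m)) (sum_mul_pderiv_add_sum_mul_pderiv_pderiv hE l)
    have h' := derivation_aeval (Polynomial.derivative' (R := k)) (truncExp E u m) (pderiv l f)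
    simp only [map_add, map_sum, map_mul, aeval_X, map_zero, algHom_C,
      Polynomial.algebraMap_eq] at h
    have hd : ∀ p : Polynomial k, Polynomial.derivative' p = Polynomial.derivative p :=
      fun _ => rfl
    simp only [hd, derivative_truncExp hpow] at h'
    refine h'.trans (eq_neg_of_add_eq_zero_right (Eq.trans ?_ h))
    exact congrArg _ (Finset.sum_congr rfl fun i _ => mul_comm _ _)
  simp only [truncExpGradient, map_sum, Polynomial.derivative_C_mul, hl]
  simp only [Matrix.mulVec, dotProduct, map_sum, map_mul, mul_neg, Finset.mul_sum,
    Finset.sum_mul, Finset.sum_neg_distrib]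
  rw [Finset.sum_comm]
  exact congrArg _ (Finset.sum_congr rfl fun i _ => Finset.sum_congr rfl fun j _ => by ring)

/-- A nilpotent linear vector field annihilating a nonsingular form of degree `n + 1 ≥ 3`
vanishes: otherwise the gradient is zero at the leading coefficient of an integral curve. -/
theorem eq_zero_of_isNilpotent_of_sum_mul_pderiv_eq_zero [CharZero k] {E : Matrix σ σ k}
    {f : MvPolynomial σ k} {n : ℕ} (hn : 2 ≤ n) (hf : f.IsHomogeneous (n + 1))
    (hns : ∀ p, f.gradientAt p = 0 → p = 0)
    (hE : ∑ i, (∑ j, C (E i j) * X j) * pderiv i f = 0) (hnil : IsNilpotent E) : E = 0 := by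
  by_contra hE0
  have : Nontrivial (Matrix σ σ k) := ⟨E, 0, hE0⟩
  obtain ⟨m, hm⟩ : ∃ m, nilpotencyClass E = m + 1 :=
    Nat.exists_eq_succ_of_ne_zero (pos_nilpotencyClass_iff.mpr hnil).ne'
  have hpow : E ^ (m + 1) = 0 := hm ▸ pow_nilpotencyClass hnil
  have hpow' : E ^ m ≠ 0 := by
    have := pow_pred_nilpotencyClass hnil
    rwa [hm, Nat.add_sub_cancel] at this
  have hm0 : 0 < m := Nat.pos_of_ne_zero fun h => by
    subst h
    exact hE0 (by simpa using hpow)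
  obtain ⟨u, hu⟩ : ∃ u, (E ^ m).mulVec u ≠ 0 := by
    by_contra! h
    exact hpow' (Matrix.ext_of_mulVec_single fun i => by rw [h, Matrix.zero_mulVec])
  set P := truncExp E u m with hP
  set q := fun w : σ → k => truncExpGradient E f u m w
  have hq : ∀ w, Polynomial.derivative (q w) = -q (E.mulVec w) :=
    derivative_truncExpGradient hE hpow u
  have hq' : ∀ (j : ℕ) w, Polynomial.derivative^[j] (q w) = (-1) ^ j * q ((E ^ j).mulVec w) := by
    intro j
    induction j with
    | zero => simp
    | succ j ih =>
      intro w
      rw [Function.iterate_succ_apply, hq, Polynomial.iterate_derivative_neg, ih,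
        Matrix.mulVec_mulVec, pow_succ, pow_succ]
      ring
  have hq0 : q 0 = 0 := by simp [q, truncExpGradient]
  have hcoeff : ∀ w, (q w).coeff (n * m) = 0 := by
    intro w
    have h := congrArg (fun p => p.coeff (n * m - (m + 1))) (hq' (m + 1) w)
    have hle : m + 1 ≤ n * m := by nlinarith
    simp only [hpow, Matrix.zero_mulVec, hq0, mul_zero,
      Polynomial.coeff_zero, Polynomial.coeff_iterate_derivative,
      Nat.sub_add_cancel hle, nsmul_eq_mul, mul_eq_zero, Nat.cast_eq_zero,
      Nat.descFactorial_eq_zero_iff_lt] at h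
    exact h.resolve_left (not_lt.mpr hle)
  have hgrad : f.gradientAt (fun i => (P i).coeff m) = 0 := by
    ext l
    have h := hcoeff (Pi.single l 1)
    simp only [q, truncExpGradient, Pi.single_apply, apply_ite Polynomial.C, map_one, map_zero,
      ite_mul, one_mul, zero_mul, Finset.sum_ite_eq', Finset.mem_univ, if_true] at h
    have hfl : (pderiv l f).IsHomogeneous n := hf.pderiv
    rw [hfl.coeff_aeval_of_natDegree_le
      (fun i => truncExp_natDegree_le E u m i)] at h
    exact h
  refine hu (funext fun i => ?_)
  have h := congrFun (hns _ hgrad) i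
  rw [hP, truncExp_coeff hpow] at h
  simpa [Nat.factorial_ne_zero] using h

/-- The polynomials `x_j ∂_i f` are linearly independent for a nonsingular form `f` of degree
at least three. -/
theorem eq_zero_of_sum_mul_pderiv_eq_zero [IsAlgClosed k] [CharZero k] {E : Matrix σ σ k}
    {f : MvPolynomial σ k} {n : ℕ} (hn : 2 ≤ n) (hf : f.IsHomogeneous (n + 1))
    (hns : ∀ p, f.gradientAt p = 0 → p = 0)
    (hE : ∑ i, (∑ j, C (E i j) * X j) * pderiv i f = 0) : E = 0 :=
  eq_zero_of_isNilpotent_of_sum_mul_pderiv_eq_zero hn hf hns hE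
    (isNilpotent_of_sum_mul_pderiv_eq_zero hn hf hns hE)

end LinearVectorField

section Substitution

variable {R S : Type*} [CommRing R] [CommRing S]

theorem substM_substM (A B : Matrix (Fin 4) (Fin 4) R) (f : MvPolynomial (Fin 4) R) :
    substM A (substM B f) = substM (B * A) f := by
  have h : (aeval (fun i => ∑ j : Fin 4, C (A i j) * X j)).comp
      (aeval (fun i => ∑ j : Fin 4, C (B i j) * X j)) =
      (aeval (fun i => ∑ j : Fin 4, C ((B * A) i j) * X j) :
        MvPolynomial (Fin 4) R →ₐ[R] MvPolynomial (Fin 4) R) := by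
    refine MvPolynomial.algHom_ext fun i => ?_
    simp only [AlgHom.comp_apply, aeval_X, map_sum, map_mul, algHom_C, Matrix.mul_apply,
      Finset.mul_sum, Finset.sum_mul, algebraMap_eq]
    rw [Finset.sum_comm]
    simp only [mul_assoc]
  exact DFunLike.congr_fun h f

theorem substM_one (f : MvPolynomial (Fin 4) R) : substM 1 f = f := by
  simp [substM, Matrix.one_apply, apply_ite (C : R → MvPolynomial (Fin 4) R)]

theorem eval_substM (A : Matrix (Fin 4) (Fin 4) R) (f : MvPolynomial (Fin 4) R) (x : Fin 4 → R) :
    eval x (substM A f) = eval (A.mulVec x) f := by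
  rw [substM, ← coe_aeval_eq_eval, RingHom.coe_coe, ← AlgHom.comp_apply, comp_aeval]
  simp [aeval_eq_eval]
  rfl

theorem map_substM (φ : R →+* S) (A : Matrix (Fin 4) (Fin 4) R) (f : MvPolynomial (Fin 4) R) :
    map φ (substM A f) = substM (A.map φ) (map φ f) := by
  induction f using MvPolynomial.induction_on with
  | C a => simp [substM]
  | add p q hp hq => simp only [substM, map_add] at hp hq ⊢; rw [hp, hq]
  | mul_X p j hp => simp only [substM, map_mul, aeval_X] at hp ⊢; rw [hp]; simp

theorem substM_one_add {F : Matrix (Fin 4) (Fin 4) R}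
    (hF : ∀ i j i' j', F i j * F i' j' = 0) (g : MvPolynomial (Fin 4) R) :
    substM (1 + F) g = g + ∑ i, (∑ j, C (F i j) * X j) * pderiv i g := by
  have hX : ∀ i, ∑ j, C ((1 + F) i j) * X j =
      X i + ∑ j, (C (F i j) * X j : MvPolynomial (Fin 4) R) := by
    intro i
    simp [Matrix.one_apply, add_mul, Finset.sum_add_distrib,
      apply_ite (C : R → MvPolynomial (Fin 4) R)]
  have hFF : ∀ i i', (∑ j, C (F i j) * X j) *
      (∑ j, C (F i' j) * X j : MvPolynomial (Fin 4) R) = 0 := by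
    intro i i'
    rw [Finset.sum_mul_sum]
    refine Finset.sum_eq_zero fun j _ => Finset.sum_eq_zero fun j' _ => ?_
    rw [mul_mul_mul_comm, ← C_mul, hF, C_0, zero_mul]
  generalize hL : (fun i => ∑ j, (C (F i j) * X j : MvPolynomial (Fin 4) R)) = L at *
  replace hL := fun i => congrFun hL i
  simp only [substM, hX, hL] at hFF ⊢
  induction g using MvPolynomial.induction_on with
  | C a => simp
  | add p q hp hq =>
    simp only [map_add, hp, hq, mul_add, Finset.sum_add_distrib]
    ring
  | mul_X p j hp =>
    have h0 : (∑ i, L i * pderiv i p) * L j = 0 := by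
      rw [Finset.sum_mul]
      exact Finset.sum_eq_zero fun i _ => by rw [mul_right_comm, hFF, zero_mul]
    have h1 : ∑ i, L i * pderiv i (p * X j) = L j * p + (∑ i, L i * pderiv i p) * X j := by
      simp only [Derivation.leibniz, pderiv_X, smul_eq_mul, mul_add, Finset.sum_add_distrib,
        Finset.sum_mul]
      congr 1
      · simp [Pi.single_apply, mul_comm]
      · exact Finset.sum_congr rfl fun i _ => by ring
    rw [map_mul, hp, aeval_X, h1]
    linear_combination h0

end Substitution

section Stabilizer

/-- The linear automorphisms of a form. -/
noncomputable def formStabilizer {k : Type*} [Field k] (f : MvPolynomial (Fin 4) k) :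
    Subgroup (Matrix.GeneralLinearGroup (Fin 4) k) where
  carrier := {A | substM (A : Matrix (Fin 4) (Fin 4) k) f = f}
  one_mem' := substM_one f
  mul_mem' {A B} hA hB := by
    simp only [Set.mem_ofPred_eq] at hA hB ⊢
    rw [Units.val_mul, ← substM_substM, hA, hB]
  inv_mem' {A} hA := by
    simp only [Set.mem_ofPred_eq] at hA ⊢
    conv_lhs => rw [← hA]
    rw [substM_substM, Units.mul_inv, substM_one]

variable {k : Type*} [Field k] {f : MvPolynomial (Fin 4) k}

theorem mem_formStabilizer {A : Matrix.GeneralLinearGroup (Fin 4) k} :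
    A ∈ formStabilizer f ↔ substM (A : Matrix (Fin 4) (Fin 4) k) f = f :=
  Iff.rfl

/-- Infinitesimal automorphisms of a nonsingular form, with values in any `k`-algebra, are
trivial. -/
theorem eq_one_of_substM_one_add [IsAlgClosed k] [CharZero k] {n : ℕ} (hn : 2 ≤ n)
    (hf : f.IsHomogeneous (n + 1)) (hns : ∀ p, f.gradientAt p = 0 → p = 0) {B : Type*}
    [CommRing B] [Algebra k B] {F : Matrix (Fin 4) (Fin 4) B}
    (hF : ∀ i j i' j', F i j * F i' j' = 0)
    (h : substM (1 + F) (map (algebraMap k B) f) = map (algebraMap k B) f) : F = 0 := by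
  rw [substM_one_add hF, add_eq_left] at h
  ext i j
  rw [Matrix.zero_apply, ← Module.forall_dual_apply_eq_zero_iff k]
  intro φ
  have key : F.map φ = 0 := by
    refine eq_zero_of_sum_mul_pderiv_eq_zero hn hf hns ?_
    ext m
    have hm := congrArg (fun p => φ (coeff m p)) h
    simp only [pderiv_map, Finset.sum_mul, coeff_sum, mul_assoc, coeff_C_mul, map_sum,
      coeff_zero, map_zero] at hm ⊢
    rw [← hm]
    refine Finset.sum_congr rfl fun i _ => Finset.sum_congr rfl fun j _ => ?_
    have hc : coeff m (X j * map (algebraMap k B) (pderiv i f)) =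
        algebraMap k B (coeff m (X j * pderiv i f)) := by
      rw [← coeff_map, map_mul, map_X]
    rw [hc, Matrix.map_apply, mul_comm (F i j), ← Algebra.smul_def, map_smul, smul_eq_mul,
      mul_comm]
  exact congrFun (congrFun key i) j

/-- The entries of a matrix and of its inverse, as functions on a linear group. -/
def glCoord (G : Subgroup (Matrix.GeneralLinearGroup (Fin 4) k)) :
    (Fin 4 × Fin 4) ⊕ (Fin 4 × Fin 4) → G → k
  | .inl p, A => (A : Matrix.GeneralLinearGroup (Fin 4) k) p.1 p.2
  | .inr p, A => (A : Matrix.GeneralLinearGroup (Fin 4) k)⁻¹ p.1 p.2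

/-- The algebra of regular functions on a linear group. -/
abbrev glCoordRing (G : Subgroup (Matrix.GeneralLinearGroup (Fin 4) k)) : Subalgebra k (G → k) :=
  Algebra.adjoin k (Set.range (glCoord G))

/-- The generic element of a linear group. -/
def genericMatrix (G : Subgroup (Matrix.GeneralLinearGroup (Fin 4) k)) :
    Matrix (Fin 4) (Fin 4) (glCoordRing G) :=
  fun i j => ⟨glCoord G (.inl (i, j)), Algebra.subset_adjoin ⟨_, rfl⟩⟩

/-- The inverse of the generic element of a linear group. -/
def genericInverse (G : Subgroup (Matrix.GeneralLinearGroup (Fin 4) k)) :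
    Matrix (Fin 4) (Fin 4) (glCoordRing G) :=
  fun i j => ⟨glCoord G (.inr (i, j)), Algebra.subset_adjoin ⟨_, rfl⟩⟩

theorem genericMatrix_mul_genericInverse
    (G : Subgroup (Matrix.GeneralLinearGroup (Fin 4) k)) :
    genericMatrix G * genericInverse G = 1 := by
  ext i j A
  have h := Matrix.ext_iff.mpr (congrArg Units.val
    (mul_inv_cancel (A : Matrix.GeneralLinearGroup (Fin 4) k))) i j
  rw [Units.val_mul, Matrix.mul_apply] at h
  rw [Matrix.mul_apply]
  simp only [AddSubmonoidClass.coe_finsetSum, Finset.sum_apply]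
  refine h.trans ?_
  simp [Matrix.one_apply]
  split_ifs <;> rfl

/-- Evaluation of regular functions at an element of a linear group. -/
def glCoordEval {G : Subgroup (Matrix.GeneralLinearGroup (Fin 4) k)} (A : G) :
    glCoordRing G →ₐ[k] k :=
  (Pi.evalAlgHom k (fun _ : G => k) A).comp (glCoordRing G).val

theorem glCoordEval_injective (G : Subgroup (Matrix.GeneralLinearGroup (Fin 4) k)) :
    Function.Injective (glCoordEval (G := G)) := by
  intro A B h
  refine Subtype.ext (Units.ext (Matrix.ext fun i j => ?_))
  exact DFunLike.congr_fun h (genericMatrix G i j)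

theorem substM_genericMatrix :
    substM (genericMatrix (formStabilizer f)) (map (algebraMap k _) f) =
      map (algebraMap k (glCoordRing (formStabilizer f))) f := by
  ext m A
  have h := congrArg (coeff m) A.2
  have h1 := congrArg (coeff m) (map_substM (glCoordEval A).toRingHom
    (genericMatrix (formStabilizer f)) (map (algebraMap k _) f))
  rw [coeff_map, map_map] at h1
  have h2 : ((glCoordEval A).toRingHom.comp (algebraMap k (glCoordRing (formStabilizer f)))) =
      RingHom.id k := rfl
  rw [h2, map_id] at h1
  refine h1.trans (h.trans ?_)
  rw [coeff_map]
  rfl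

theorem formallyUnramified_glCoordRing [IsAlgClosed k] [CharZero k] {n : ℕ} (hn : 2 ≤ n)
    (hf : f.IsHomogeneous (n + 1)) (hns : ∀ p, f.gradientAt p = 0 → p = 0) :
    Algebra.FormallyUnramified k (glCoordRing (formStabilizer f)) := by
  rw [Algebra.FormallyUnramified.iff_comp_injective]
  intro B _ _ I hI φ ψ h
  set M := genericMatrix (formStabilizer f)
  set N := genericInverse (formStabilizer f)
  have hMN (χ : glCoordRing (formStabilizer f) →ₐ[k] B) : M.map χ * N.map χ = 1 := by
    have := congrArg (fun T => T.map χ) (genericMatrix_mul_genericInverse (formStabilizer f))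
    simpa only [Matrix.map_mul, Matrix.map_one χ (map_zero χ) (map_one χ)] using this
  have hM (χ : glCoordRing (formStabilizer f) →ₐ[k] B) :
      substM (M.map χ) (map (algebraMap k B) f) = map (algebraMap k B) f := by
    have := congrArg (map χ.toRingHom) (substM_genericMatrix (f := f))
    rw [map_substM, map_map] at this
    have h2 : χ.toRingHom.comp (algebraMap k (glCoordRing (formStabilizer f))) =
      algebraMap k B := χ.comp_algebraMap
    rwa [h2] at this
  have hdiff : ∀ r, ψ r - φ r ∈ I := by
    intro r
    have := DFunLike.congr_fun h r
    exact Ideal.Quotient.eq.mp this.symm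
  set F : Matrix (Fin 4) (Fin 4) B := (M.map ψ - M.map φ) * N.map φ with hFdef
  have hFI : ∀ i j, F i j ∈ I := fun i j => by
    rw [hFdef, Matrix.mul_apply]
    exact Ideal.sum_mem _ fun l _ => I.mul_mem_right _ (hdiff _)
  have hFF : ∀ i j i' j', F i j * F i' j' = 0 := fun i j i' j' => by
    have := Ideal.mul_mem_mul (hFI i j) (hFI i' j')
    rwa [← pow_two, hI] at this
  have hF1 : 1 + F = M.map ψ * N.map φ := by
    rw [hFdef, sub_mul, hMN φ]
    abel
  have hF : F = 0 := by
    refine eq_one_of_substM_one_add hn hf hns hFF ?_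
    rw [hF1, ← substM_substM, hM ψ]
    conv_lhs => rw [← hM φ]
    rw [substM_substM, hMN φ, substM_one]
  rw [hF, add_zero] at hF1
  have hN : N.map φ = N.map ψ := (left_inv_eq_right_inv
    (mul_eq_one_comm.mp (hMN ψ)) hF1.symm).symm
  have hMeq : M.map φ = M.map ψ := left_inv_eq_right_inv (hMN φ)
    (mul_eq_one_comm.mp hF1.symm)
  refine AlgHom.adjoin_ext ?_
  rintro _ ⟨p | p, rfl⟩
  · exact congrFun (congrFun hMeq p.1) p.2
  · exact congrFun (congrFun hN p.1) p.2

theorem finite_formStabilizer [IsAlgClosed k] [CharZero k] {n : ℕ} (hn : 2 ≤ n)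
    (hf : f.IsHomogeneous (n + 1)) (hns : ∀ p, f.gradientAt p = 0 → p = 0) :
    Finite (formStabilizer f) := by
  have := formallyUnramified_glCoordRing hn hf hns
  have : Algebra.FiniteType k (glCoordRing (formStabilizer f)) :=
    (Subalgebra.fg_iff_finiteType _).mp ⟨(Set.finite_range (glCoord _)).toFinset, by simp⟩
  have := Algebra.FormallyUnramified.finite_of_free k (glCoordRing (formStabilizer f))
  exact Finite.of_injective _ (glCoordEval_injective (formStabilizer f))

end Stabilizer

/-- A set of at most four elements of exponent `49` which is stable under `x ↦ x⁻³` consists of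
powers of a single element of exponent `7`. -/
theorem exists_generator_of_pow_mem {M : Type*} [Monoid M] {s : Finset M} (hne : s.Nonempty)
    (hcard : s.card ≤ 4) (h49 : ∀ x ∈ s, x ^ 49 = 1) (hs : ∀ x ∈ s, x ^ 46 ∈ s) :
    ∃ x ∈ s, x ^ 7 = 1 ∧ ∀ y ∈ s, ∃ n : ℕ, y = x ^ n := by
  classical
  have : Fact (Nat.Prime 7) := ⟨by norm_num⟩
  have hred : ∀ {x : M} {N : ℕ}, x ^ N = 1 → ∀ a b : ℕ, a % N = b % N → x ^ a = x ^ b := by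
    intro x N hx a b hab
    rw [pow_eq_pow_mod a hx, pow_eq_pow_mod b hx, hab]
  have h7 : ∀ x ∈ s, x ^ 7 = 1 := by
    intro x hx
    by_contra hx7
    have hord : orderOf x = 49 := orderOf_eq_prime_pow (p := 7) (n := 1) (by simpa using hx7)
      (h49 x hx)
    have hmem : ∀ j : ℕ, x ^ 46 ^ j ∈ s := by
      intro j
      induction j with
      | zero => simpa using hx
      | succ j ih => rw [pow_succ, pow_mul]; exact hs _ ih
    have hsub : ({1, 46, 9, 22, 32} : Finset ℕ).image (x ^ ·) ⊆ s := by
      intro y hy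
      simp only [Finset.mem_image, Finset.mem_insert, Finset.mem_singleton] at hy
      obtain ⟨e, he, rfl⟩ := hy
      rcases he with rfl | rfl | rfl | rfl | rfl
      · exact hred (h49 x hx) 1 (46 ^ 0) (by norm_num) ▸ hmem 0
      · exact hred (h49 x hx) 46 (46 ^ 1) (by norm_num) ▸ hmem 1
      · exact hred (h49 x hx) 9 (46 ^ 2) (by norm_num) ▸ hmem 2
      · exact hred (h49 x hx) 22 (46 ^ 3) (by norm_num) ▸ hmem 3
      · exact hred (h49 x hx) 32 (46 ^ 4) (by norm_num) ▸ hmem 4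
    have h5 := Finset.card_le_card hsub
    rw [Finset.card_image_of_injOn (pow_injOn_Iio_orderOf.mono fun e he => by
      simp only [Finset.coe_insert, Finset.coe_singleton, Set.mem_insert_iff,
        Set.mem_singleton_iff] at he
      rw [Set.mem_Iio, hord]
      omega)] at h5
    have : ({1, 46, 9, 22, 32} : Finset ℕ).card = 5 := rfl
    omega
  by_cases hall : ∀ x ∈ s, x = 1
  · obtain ⟨x, hx⟩ := hne
    exact ⟨x, hx, h7 x hx, fun y hy => ⟨0, by rw [hall y hy, pow_zero]⟩⟩
  push Not at hall
  obtain ⟨x, hx, hx1⟩ := hall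
  refine ⟨x, hx, h7 x hx, fun y hy => ?_⟩
  by_contra! hyx
  have hy1 : y ≠ 1 := by simpa using hyx 0
  have h4 : ∀ z ∈ s, z ^ 4 ∈ s := fun z hz =>
    hred (h7 z hz) 46 4 (by norm_num) ▸ hs z hz
  have hinj : ∀ z ∈ s, z ≠ 1 → ∀ a < 7, ∀ b < 7, z ^ a = z ^ b → a = b := by
    intro z hz hz1 a ha b hb hab
    have hord := orderOf_eq_prime (h7 z hz) hz1
    exact pow_injOn_Iio_orderOf (by rw [Set.mem_Iio, hord]; exact ha)
      (by rw [Set.mem_Iio, hord]; exact hb) hab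
  have hxx : ({1, 4, 2} : Finset ℕ).image (x ^ ·) ⊆ s := by
    intro z hz
    simp only [Finset.mem_image, Finset.mem_insert, Finset.mem_singleton] at hz
    obtain ⟨e, he, rfl⟩ := hz
    rcases he with rfl | rfl | rfl
    · simpa using hx
    · exact h4 x hx
    · rw [hred (h7 x hx) 2 (4 * 4) (by norm_num), pow_mul]
      exact h4 _ (h4 x hx)
  have hyy : ({1, 4} : Finset ℕ).image (y ^ ·) ⊆ s := by
    intro z hz
    simp only [Finset.mem_image, Finset.mem_insert, Finset.mem_singleton] at hz
    obtain ⟨e, he, rfl⟩ := hz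
    rcases he with rfl | rfl
    · simpa using hy
    · exact h4 y hy
  have hdisj : Disjoint (({1, 4, 2} : Finset ℕ).image (x ^ ·))
      (({1, 4} : Finset ℕ).image (y ^ ·)) := by
    rw [Finset.disjoint_left]
    intro z hzx hzy
    simp only [Finset.mem_image, Finset.mem_insert, Finset.mem_singleton] at hzx hzy
    obtain ⟨a, -, rfl⟩ := hzx
    obtain ⟨b, hb, hab⟩ := hzy
    rcases hb with rfl | rfl
    · exact hyx a (by simpa using hab)
    · refine hyx (a * 2) ?_
      rw [pow_mul, ← hab, ← pow_mul]
      simpa using hred (h7 y hy) 1 (4 * 2) (by norm_num)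
  have h5 := Finset.card_le_card (Finset.union_subset hxx hyy)
  rw [Finset.card_union_of_disjoint hdisj, Finset.card_image_of_injOn, Finset.card_image_of_injOn]
    at h5
  · have h3 : ({1, 4, 2} : Finset ℕ).card = 3 := rfl
    have h2 : ({1, 4} : Finset ℕ).card = 2 := rfl
    omega
  · intro a ha b hb hab
    simp only [Finset.coe_insert, Finset.coe_singleton, Set.mem_insert_iff,
      Set.mem_singleton_iff] at ha hb
    exact hinj y hy hy1 a (by omega) b (by omega) hab
  · intro a ha b hb hab
    simp only [Finset.coe_insert, Finset.coe_singleton, Set.mem_insert_iff,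
      Set.mem_singleton_iff] at ha hb
    exact hinj x hx hx1 a (by omega) b (by omega) hab

section Weights

variable {k : Type*} [Field k] {σ : Type*} [Fintype σ] [DecidableEq σ]

/-- The space of simultaneous eigenvectors of a linear group for a given family of
eigenvalues. -/
def glWeightSpace (P : Subgroup (Matrix.GeneralLinearGroup σ k)) (χ : P → k) :
    Submodule k (σ → k) :=
  ⨅ A : P, Module.End.eigenspace (Matrix.toLin' (A.1 : Matrix σ σ k)) (χ A)

theorem mem_glWeightSpace {P : Subgroup (Matrix.GeneralLinearGroup σ k)} {χ : P → k}
    {v : σ → k} :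
    v ∈ glWeightSpace P χ ↔ ∀ A : P, (A.1 : Matrix σ σ k).mulVec v = χ A • v := by
  simp [glWeightSpace]

theorem maxGenEigenspace_toLin'_eq [CharZero k] {A : Matrix σ σ k} {N : ℕ} (hN : N ≠ 0)
    (hA : A ^ N = 1) (μ : k) :
    Module.End.maxGenEigenspace (Matrix.toLin' A) μ =
      Module.End.eigenspace (Matrix.toLin' A) μ := by
  refine Module.End.IsFinitelySemisimple.maxGenEigenspace_eq_eigenspace
    (Module.End.IsSemisimple.isFinitelySemisimple ?_) μ
  refine Module.End.isSemisimple_of_squarefree_aeval_eq_zero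
    (p := Polynomial.X ^ N - 1) ?_ ?_
  · exact (Polynomial.separable_X_pow_sub_C (1 : k) (Nat.cast_ne_zero.mpr hN)
      one_ne_zero).squarefree
  · rw [map_sub, map_pow, Polynomial.aeval_X, map_one, ← Matrix.toLin'_pow, hA, Matrix.toLin'_one]
    exact sub_self _

variable {P : Subgroup (Matrix.GeneralLinearGroup σ k)}

theorem glWeightSpace_eq_iInf_maxGenEigenspace [CharZero k] {N : ℕ} (hN : N ≠ 0)
    (hP : ∀ A : P, A ^ N = 1) (χ : P → k) :
    glWeightSpace P χ =
      ⨅ A : P, Module.End.maxGenEigenspace (Matrix.toLin' (A.1 : Matrix σ σ k)) (χ A) := by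
  refine iInf_congr fun A => (maxGenEigenspace_toLin'_eq hN ?_ _).symm
  exact congrArg (fun B : P => (B.1 : Matrix σ σ k)) (hP A)

theorem commute_toLin' (hcomm : ∀ A B : P, A * B = B * A) (A B : P) :
    Commute (Matrix.toLin' (A.1 : Matrix σ σ k)) (Matrix.toLin' (B.1 : Matrix σ σ k)) := by
  have h := congrArg (fun B : P => (B.1 : Matrix σ σ k)) (hcomm A B)
  exact Commute.map (show Commute (A.1 : Matrix σ σ k) B.1 from h) Matrix.toLinAlgEquiv'

theorem iSupIndep_glWeightSpace [CharZero k] {N : ℕ} (hN : N ≠ 0) (hP : ∀ A : P, A ^ N = 1)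
    (hcomm : ∀ A B : P, A * B = B * A) : iSupIndep (glWeightSpace P) := by
  rw [funext (glWeightSpace_eq_iInf_maxGenEigenspace hN hP)]
  exact Module.End.independent_iInf_maxGenEigenspace_of_forall_mapsTo _ fun A B μ =>
    Module.End.mapsTo_maxGenEigenspace_of_comm (commute_toLin' hcomm B A) μ

theorem iSup_glWeightSpace [IsAlgClosed k] [CharZero k] {N : ℕ} (hN : N ≠ 0)
    (hP : ∀ A : P, A ^ N = 1) (hcomm : ∀ A B : P, A * B = B * A) :
    ⨆ χ, glWeightSpace P χ = ⊤ := by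
  rw [funext (glWeightSpace_eq_iInf_maxGenEigenspace hN hP)]
  exact Module.End.iSup_iInf_maxGenEigenspace_eq_top_of_iSup_maxGenEigenspace_eq_top_of_commute _
    (fun A B _ => commute_toLin' hcomm A B) fun A => Module.End.iSup_maxGenEigenspace_eq_top _

theorem pow_eq_one_of_glWeightSpace_ne_bot {N : ℕ} (hP : ∀ A : P, A ^ N = 1) {χ : P → k}
    (hχ : glWeightSpace P χ ≠ ⊥) : χ ^ N = 1 := by
  obtain ⟨v, hv, hv0⟩ := Submodule.exists_mem_ne_zero_of_ne_bot hχ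
  ext A
  have hA := mem_glWeightSpace.mp hv A
  have hpow : ∀ n : ℕ, ((A.1 : Matrix σ σ k) ^ n).mulVec v = χ A ^ n • v := by
    intro n
    induction n with
    | zero => simp
    | succ n ih => rw [pow_succ, ← Matrix.mulVec_mulVec, hA, Matrix.mulVec_smul, ih, smul_smul,
        pow_succ']
  have h1 : (A.1 : Matrix σ σ k) ^ N = 1 :=
    congrArg (fun B : P => (B.1 : Matrix σ σ k)) (hP A)
  have h2 := hpow N
  rw [h1, Matrix.one_mulVec] at h2
  exact smul_left_injective k hv0 (by simpa using h2.symm)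

end Weights

/-- For a form `f` of degree four fixed by `P`, the set of weights of `P` is stable under
`χ ↦ χ⁻³`: the gradient at a vector of weight `χ` is a covector of weight `χ³`. -/
theorem exists_glWeightSpace_ne_bot {k : Type*} [Field k] {f : MvPolynomial (Fin 4) k} {n : ℕ}
    (hf : f.IsHomogeneous (n + 1)) (hns : ∀ p, f.gradientAt p = 0 → p = 0)
    {P : Subgroup (Matrix.GeneralLinearGroup (Fin 4) k)} (hPf : P ≤ formStabilizer f)
    (htop : ⨆ χ, glWeightSpace P χ = ⊤) {χ : P → k} (hχ : glWeightSpace P χ ≠ ⊥) :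
    ∃ ψ : P → k, glWeightSpace P ψ ≠ ⊥ ∧ χ ^ n * ψ = 1 := by
  obtain ⟨v, hv, hv0⟩ := Submodule.exists_mem_ne_zero_of_ne_bot hχ
  have hgrad : ∀ (A : P) (i : Fin 4), f.gradientAt v i =
      χ A ^ n * ∑ l, f.gradientAt v l * (A.1 : Matrix (Fin 4) (Fin 4) k) l i := by
    intro A i
    have hA := mem_glWeightSpace.mp hv A
    have h := derivation_aeval (pderiv i)
      (fun i => ∑ j : Fin 4, C ((A.1 : Matrix (Fin 4) (Fin 4) k) i j) * X j) f
    have hstab : aeval (fun i => ∑ j : Fin 4, C ((A.1 : Matrix (Fin 4) (Fin 4) k) i j) * X j) f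
      = f := hPf A.2
    rw [hstab] at h
    rw [gradientAt, h, map_sum, Finset.mul_sum]
    refine Finset.sum_congr rfl fun l _ => ?_
    have hl : eval v (substM (A.1 : Matrix (Fin 4) (Fin 4) k) (pderiv l f)) =
        χ A ^ n * eval v (pderiv l f) := by
      have hfl : (pderiv l f).IsHomogeneous n := hf.pderiv
      rw [eval_substM, hA, hfl.eval_smul]
    rw [map_mul, ← substM, hl, gradientAt, mul_assoc]
    congr 2
    simp [Derivation.leibniz, pderiv_X, Pi.single_apply]
  by_contra! hψ
  have hker : ∀ ψ : P → k, ∀ w ∈ glWeightSpace P ψ, ∑ i, f.gradientAt v i * w i = 0 := by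
    intro ψ w hw
    by_contra hne
    have hw0 : w ≠ 0 := fun h => hne (by simp [h])
    refine hψ ψ (fun h => hw0 (by simpa [h] using hw)) (funext fun A => ?_)
    have hA : ∀ l, ∑ i, (A.1 : Matrix (Fin 4) (Fin 4) k) l i * w i = ψ A * w l :=
      fun l => congrFun (mem_glWeightSpace.mp hw A) l
    have h : ∑ i, f.gradientAt v i * w i =
        (χ A ^ n * ψ A) * ∑ i, f.gradientAt v i * w i := by
      calc ∑ i, f.gradientAt v i * w i
          = ∑ i, (χ A ^ n * ∑ l, f.gradientAt v l * (A.1 : Matrix (Fin 4) (Fin 4) k) l i) * w i :=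
            Finset.sum_congr rfl fun i _ => congrArg (· * w i) (hgrad A i)
        _ = χ A ^ n * ∑ l, f.gradientAt v l *
              ∑ i, (A.1 : Matrix (Fin 4) (Fin 4) k) l i * w i := by
            simp only [mul_assoc, Finset.sum_mul]
            rw [← Finset.mul_sum, Finset.sum_comm]
            simp only [Finset.mul_sum]
        _ = (χ A ^ n * ψ A) * ∑ i, f.gradientAt v i * w i := by
            simp only [hA, mul_assoc, Finset.mul_sum, mul_left_comm]
    exact mul_right_cancel₀ hne (h.symm.trans (one_mul _).symm)
  let L : (Fin 4 → k) →ₗ[k] k := ∑ i, f.gradientAt v i • LinearMap.proj i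
  have hL : ∀ w, L w = ∑ i, f.gradientAt v i * w i := fun w => by simp [L]
  have hL0 : ⊤ ≤ LinearMap.ker L := by
    rw [← htop]
    exact iSup_le fun ψ w hw => by rw [LinearMap.mem_ker, hL, hker ψ w hw]
  refine hv0 (hns v (funext fun i => ?_))
  have hi := hL (Pi.single i 1)
  rw [LinearMap.mem_ker.mp (hL0 Submodule.mem_top)] at hi
  simpa [Pi.single_apply] using hi.symm

/-- A group of linear automorphisms of a nonsingular quartic form does not have order `49`: it
would be commutative, and its weights, hence the group itself, would be determined by a single
character of order dividing `7`. -/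
theorem card_ne_forty_nine {k : Type*} [Field k] [IsAlgClosed k] [CharZero k]
    {f : MvPolynomial (Fin 4) k} (hf : f.IsHomogeneous 4)
    (hns : ∀ p, f.gradientAt p = 0 → p = 0)
    {P : Subgroup (Matrix.GeneralLinearGroup (Fin 4) k)} (hPf : P ≤ formStabilizer f) :
    Nat.card P ≠ 49 := by
  intro hcard
  have : Fact (Nat.Prime 7) := ⟨by norm_num⟩
  have hcomm := (IsPGroup.isMulCommutative_of_card_eq_prime_sq (p := 7) (G := P)
    (by rw [hcard]; norm_num)).is_comm.comm
  have hP : ∀ A : P, A ^ 49 = 1 := fun A => hcard ▸ pow_card_eq_one'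
  have hindep := iSupIndep_glWeightSpace (by norm_num) hP hcomm
  have htop := iSup_glWeightSpace (by norm_num) hP hcomm
  have hfin : Finite {χ : P → k // glWeightSpace P χ ≠ ⊥} :=
    WellFoundedGT.finite_ne_bot_of_iSupIndep hindep
  have := Fintype.ofFinite {χ : P → k // glWeightSpace P χ ≠ ⊥}
  let s : Finset (P → k) := Set.Finite.toFinset (s := {χ | glWeightSpace P χ ≠ ⊥}) hfin
  have hmem : ∀ χ, χ ∈ s ↔ glWeightSpace P χ ≠ ⊥ := fun χ => Set.Finite.mem_toFinset _
  have hs4 : s.card ≤ 4 := by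
    have h := hindep.subtype_ne_bot_le_finrank
    rw [Module.finrank_fin_fun] at h
    rwa [← Fintype.card_of_subtype s hmem]
  have hsne : s.Nonempty := by
    by_contra hempty
    have hbot : ∀ χ, glWeightSpace P χ = ⊥ := fun χ => by
      by_contra h
      exact hempty ⟨χ, (hmem χ).mpr h⟩
    simp [hbot] at htop
  have h49 : ∀ χ ∈ s, χ ^ 49 = 1 := fun χ hχ =>
    pow_eq_one_of_glWeightSpace_ne_bot hP ((hmem χ).mp hχ)
  obtain ⟨χ, -, hχ7, hχ⟩ := exists_generator_of_pow_mem hsne hs4 h49 fun χ hχ => by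
    obtain ⟨ψ, hψ, hχψ⟩ := exists_glWeightSpace_ne_bot (n := 3) hf hns hPf htop ((hmem χ).mp hχ)
    have : χ ^ 46 = ψ := by
      calc χ ^ 46 = χ ^ 46 * (χ ^ 3 * ψ) := by rw [hχψ, mul_one]
        _ = χ ^ 49 * ψ := by ring
        _ = ψ := by rw [h49 χ hχ, one_mul]
    rw [this]
    exact (hmem ψ).mpr hψ
  have hinj : Function.Injective χ := by
    intro A B hAB
    have hle : ⊤ ≤ LinearMap.eqLocus (Matrix.toLin' (A.1 : Matrix (Fin 4) (Fin 4) k))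
        (Matrix.toLin' (B.1 : Matrix (Fin 4) (Fin 4) k)) := by
      rw [← htop]
      refine iSup_le fun ψ w hw => ?_
      rw [LinearMap.mem_eqLocus, Matrix.toLin'_apply, Matrix.toLin'_apply,
        mem_glWeightSpace.mp hw A, mem_glWeightSpace.mp hw B]
      rcases eq_or_ne w 0 with rfl | hw0
      · simp
      · obtain ⟨n, rfl⟩ := hχ ψ ((hmem ψ).mpr fun h => hw0 (by simpa [h] using hw))
        rw [Pi.pow_apply, Pi.pow_apply, hAB]
    have heq : Matrix.toLin' (A.1 : Matrix (Fin 4) (Fin 4) k) =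
        Matrix.toLin' (B.1 : Matrix _ _ k) :=
      LinearMap.ext fun w => hle Submodule.mem_top
    exact Subtype.ext (Units.ext (Matrix.toLin'.injective heq))
  classical
  have hroot : ∀ A, χ A ∈ (Polynomial.nthRoots 7 (1 : k)).toFinset := fun A => by
    rw [Multiset.mem_toFinset, Polynomial.mem_nthRoots (by norm_num)]
    exact congrFun hχ7 A
  have hle := Nat.card_le_card_of_injective
    (fun A => (⟨χ A, hroot A⟩ : (Polynomial.nthRoots 7 (1 : k)).toFinset))
    fun A B h => hinj (congrArg Subtype.val h)
  rw [hcard, Nat.card_eq_fintype_card, Fintype.card_coe] at hle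
  have := (Multiset.toFinset_card_le _).trans (Polynomial.card_nthRoots 7 (1 : k))
  omega

/-- Over an algebraically closed field, every projective automorphism of a form lifts to a linear
automorphism. -/
theorem pautCard_eq_card_range {k : Type*} [Field k] [IsAlgClosed k] {f : MvPolynomial (Fin 4) k}
    (hf : f.IsHomogeneous 4) :
    pautCard f = Nat.card ((QuotientGroup.mk' (Subgroup.center
      (Matrix.GeneralLinearGroup (Fin 4) k))).comp (formStabilizer f).subtype).range := by
  refine Nat.card_congr (Equiv.subtypeEquivRight fun x => ⟨?_, ?_⟩)
  · rintro ⟨A, rfl, c, hc⟩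
    obtain ⟨s, hs⟩ := IsAlgClosed.exists_pow_nat_eq (c : k) (n := 4) (by norm_num)
    have hs0 : s ≠ 0 := by
      rintro rfl
      exact c.ne_zero (by simpa using hs.symm)
    let z := Matrix.GeneralLinearGroup.scalar (Fin 4) (Units.mk0 s hs0)
    have hz : z ∈ Subgroup.center (Matrix.GeneralLinearGroup (Fin 4) k) := by
      rw [Matrix.GeneralLinearGroup.center_eq_range_scalar]
      exact ⟨_, rfl⟩
    have hmem : (A * z)⁻¹ ∈ formStabilizer f := by
      rw [mem_formStabilizer]
      refine MvPolynomial.funext fun x => ?_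
      rw [eval_substM]
      have h1 := congrArg (eval (s⁻¹ • x)) hc
      rw [eval_substM, smul_eval, hf.eval_smul, ← hs] at h1
      have hzx : ((A * z)⁻¹ : Matrix.GeneralLinearGroup (Fin 4) k).1.mulVec x =
          (A⁻¹ : Matrix.GeneralLinearGroup (Fin 4) k).1.mulVec (s⁻¹ • x) := by
        have hz' : (z⁻¹ : Matrix.GeneralLinearGroup (Fin 4) k).1 = Matrix.scalar (Fin 4) s⁻¹ := by
          rw [← map_inv]
          rfl
        rw [Subgroup.mem_center_iff.mp hz A, mul_inv_rev, Units.val_mul, hz',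
          ← Matrix.mulVec_mulVec]
        congr 1
        ext i
        simp [Matrix.scalar_apply, Matrix.mulVec_diagonal]
      rw [hzx, h1]
      field_simp
    refine ⟨⟨A * z, (inv_mem_iff).mp hmem⟩, ?_⟩
    exact QuotientGroup.mk_mul_of_mem A hz
  · rintro ⟨A, rfl⟩
    refine ⟨A, rfl, 1, ?_⟩
    rw [Units.val_one, one_smul]
    exact (formStabilizer f).inv_mem A.2

/-- for a nonsingular quartic form `f ∈ k[x,y,z,t]`, `49` does not divide
`|Paut(f)|`. -/
theorem stmt_12 {k : Type*} [Field k] [IsAlgClosed k] [CharZero k]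
    (f : MvPolynomial (Fin 4) k) (hhom : f.IsHomogeneous 4) (hf : f ≠ 0)
    (hns : ¬ f.IsSingularForm) :
    ¬ (49 ∣ pautCard f) := by
  have hns' : ∀ p, f.gradientAt p = 0 → p = 0 := fun p hp => by
    by_contra h0
    exact hns ⟨p, h0, congrFun hp⟩
  have : Finite (formStabilizer f) := finite_formStabilizer (n := 3) (by norm_num) hhom hns'
  intro h49
  rw [pautCard_eq_card_range hhom] at h49
  have : Fact (Nat.Prime 7) := ⟨by norm_num⟩
  obtain ⟨P, hP⟩ := Sylow.exists_subgroup_card_pow_prime (G := formStabilizer f) 7 (n := 2)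
    (h49.trans (Subgroup.card_range_dvd _))
  refine card_ne_forty_nine hhom hns' (P := P.map (formStabilizer f).subtype) ?_ ?_
  · exact (Subgroup.map_le_range _ _).trans (Subgroup.range_subtype _).le
  · rw [Subgroup.card_map_of_injective (Subgroup.subtype_injective _), hP]
    norm_num
end
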